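/- Let (Ω, 𝓕, μ) be a probability space, let α ∈ [0,1], and let A, B, F be measurable events. Assume: (i) μ(A ∩ F ∩ B)·μ(B) = μ(A ∩ B)·μ(F ∩ B) and μ(A ∩ F ∩ Bᶜ)·μ(Bᶜ) = μ(A ∩ Bᶜ)·μ(F ∩ Bᶜ); (ii) μ(A ∩ B) ≥ (1 − α)·μ(B) and μ(A ∩ Bᶜ) ≥ (1 − α)·μ(Bᶜ); (iii) A ∩ F ⊆ B. Then μ(B ∩ F) ≥ (1 − α)·μ(F). (No positivity assumptions on μ(B), μ(Bᶜ) or μ(F) are needed in this form.) -/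

import Mathlib

open MeasureTheory

/-- C-MICL ground-truth feasibility guarantee, product (measure) form with no
positivity assumptions. -/
theorem cmicl_feasibility_product
    {Ω : Type*} [MeasurableSpace Ω] (μ : Measure Ω) [IsProbabilityMeasure μ]
    (α : ℝ) (hα0 : 0 ≤ α) (hα1 : α ≤ 1)
    (A B F : Set Ω) (hA : MeasurableSet A) (hB : MeasurableSet B) (hF : MeasurableSet F)
    (hci1 : μ (A ∩ F ∩ B) * μ B = μ (A ∩ B) * μ (F ∩ B))
    (hci2 : μ (A ∩ F ∩ Bᶜ) * μ Bᶜ = μ (A ∩ Bᶜ) * μ (F ∩ Bᶜ))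
    (hcov1 : ENNReal.ofReal (1 - α) * μ B ≤ μ (A ∩ B))
    (hcov2 : ENNReal.ofReal (1 - α) * μ Bᶜ ≤ μ (A ∩ Bᶜ))
    (hsub : A ∩ F ⊆ B) :
    ENNReal.ofReal (1 - α) * μ F ≤ μ (B ∩ F) := by
  have hc : ENNReal.ofReal (1 - α) ≤ 1 := by
    rw [ENNReal.ofReal_le_one]; linarith
  have hempty : A ∩ F ∩ Bᶜ = ∅ := by
    ext x
    simp only [Set.mem_inter_iff, Set.mem_compl_iff, Set.mem_empty_iff_false, iff_false]
    rintro ⟨h, hx⟩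
    exact hx (hsub h)
  rw [hempty, measure_empty, zero_mul] at hci2
  have hzero : ENNReal.ofReal (1 - α) * μ (F ∩ Bᶜ) = 0 := by
    rcases mul_eq_zero.mp hci2.symm with h | h
    · rw [h] at hcov2
      refine le_antisymm (le_trans ?_ hcov2) (zero_le)
      gcongr
      exact Set.inter_subset_right
    · rw [h, mul_zero]
  have hsplit : μ F = μ (F ∩ B) + μ (F ∩ Bᶜ) := by
    rw [← Set.diff_eq]
    exact (measure_inter_add_diff F hB).symm
  rw [hsplit, mul_add, hzero, add_zero, Set.inter_comm B F]
  exact mul_le_of_le_one_left' hc
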